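/- arXiv:2102.07100 — 3 statements merged into one kernel-verified Lean document; each statement's English description precedes it below -/
import Mathlib

section
/- Let G be a finite simple graph whose vertex set V is partitioned into a set A of anchors and a set S = V \ A of agents, and let G' be the associated split digraph. Fix an agent v ∈ S. If Q₁ and Q₂ are directed paths in G' from (v, out) to Ω that share no arc, then the paths in G from v to anchors obtained by projecting Q₁ and Q₂ end at distinct anchors and share no vertex other than v. -/
/-!
STATEMENT 3. With the split digraph `G'` of `G` and anchor set `A` as below, fix an
agent `v`.  If `L₁`, `L₂` are directed paths in `G'` from `(v, out)` to the sink `Ω`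
sharing no arc (arcs of a list `L` being the consecutive pairs `L.zip L.tail`), then
the paths in `G` from `v` to anchors obtained by projecting `L₁` and `L₂` (replacing
each pair `(w, in), (w, out)` by the agent `w` and the second-to-last vertex by the
corresponding anchor, so that the support of the projected path is
`Lᵢ.filterMap projV`) end at distinct anchors and share no vertex other than `v`.
-/
/-- The vertex type of the split digraph: split agents `(↥Aᶜ × Bool)`
(`false` = "in", `true` = "out"), anchors `↥A`, and the virtual sink `Ω = Sum.inr (Sum.inr ())`. -/
abbrev SplitV {V : Type*} (A : Set V) : Type _ := (↥(Aᶜ) × Bool) ⊕ (↥A ⊕ Unit)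

/-- The arcs of the split digraph `G'` associated with `G` and the anchor set `A`. -/
inductive SplitArc {V : Type*} (G : SimpleGraph V) (A : Set V) :
    SplitV A → SplitV A → Prop
  | in_out (v : ↥(Aᶜ)) :
      SplitArc G A (Sum.inl (v, false)) (Sum.inl (v, true))
  | out_in (v w : ↥(Aᶜ)) (h : G.Adj ↑v ↑w) :
      SplitArc G A (Sum.inl (v, true)) (Sum.inl (w, false))
  | out_anchor (v : ↥(Aᶜ)) (a : ↥A) (h : G.Adj ↑v ↑a) :
      SplitArc G A (Sum.inl (v, true)) (Sum.inr (Sum.inl a))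
  | anchor_sink (a : ↥A) :
      SplitArc G A (Sum.inr (Sum.inl a)) (Sum.inr (Sum.inr ()))

/-- `L` is a directed path (no repeated vertices) from `x` to `y` for the arc relation `R`. -/
def IsDipath {α : Type*} (R : α → α → Prop) (x y : α) (L : List α) : Prop :=
  L.Chain' R ∧ L.Nodup ∧ L.head? = some x ∧ L.getLast? = some y

/-- Projection of split-digraph vertices back to `V`: an "out"-copy `(w, out)` of an
agent projects to `w`, an anchor projects to itself, while "in"-copies and the sink
are dropped. -/
def projV {V : Type*} {A : Set V} : SplitV A → Option V
  | Sum.inl (w, b) => if b then some ↑w else none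
  | Sum.inr (Sum.inl a) => some ↑a
  | Sum.inr (Sum.inr _) => none

theorem List.IsChain.exists_mem_zip_tail_right {α : Type*} {R : α → α → Prop} {L : List α}
    (hL : L.IsChain R) {x : α} (hx : x ∈ L) (hlast : L.getLast? ≠ some x) :
    ∃ y, (x, y) ∈ L.zip L.tail ∧ R x y := by
  induction L with
  | nil => simp at hx
  | cons a t ih =>
    cases t with
    | nil => simp_all
    | cons b t =>
      rw [List.isChain_cons_cons] at hL
      rcases List.mem_cons.1 hx with rfl | hx
      · exact ⟨b, by simp, hL.1⟩
      · obtain ⟨y, hy, hR⟩ := ih hL.2 hx (by simpa using hlast)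
        exact ⟨y, List.mem_cons_of_mem _ hy, hR⟩

theorem List.IsChain.exists_mem_zip_tail_left {α : Type*} {R : α → α → Prop} {L : List α}
    (hL : L.IsChain R) {x : α} (hx : x ∈ L) (hhead : L.head? ≠ some x) :
    ∃ y, (y, x) ∈ L.zip L.tail ∧ R y x := by
  induction L with
  | nil => simp at hx
  | cons a t ih =>
    have hxt : x ∈ t := (List.mem_cons.1 hx).resolve_left fun h => hhead (by simp [h])
    cases t with
    | nil => simp at hxt
    | cons b t =>
      rw [List.isChain_cons_cons] at hL
      by_cases hb : b = x
      · subst hb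
        exact ⟨a, by simp, hL.1⟩
      · obtain ⟨y, hy, hR⟩ := ih hL.2 hxt (by simpa using hb)
        exact ⟨y, List.mem_cons_of_mem _ hy, hR⟩

section SplitDigraph

variable {V : Type*} {G : SimpleGraph V} {A : Set V}

theorem projV_eq_some_iff {x : SplitV A} {w : V} :
    projV x = some w ↔
      (∃ h : w ∈ Aᶜ, x = Sum.inl (⟨w, h⟩, true)) ∨ ∃ h : w ∈ A, x = Sum.inr (Sum.inl ⟨w, h⟩) := by
  rcases x with ⟨⟨u, hu⟩, _ | _⟩ | ⟨u, hu⟩ | _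
  · simp [projV]
  · constructor
    · intro h
      obtain rfl : u = w := by simpa [projV] using h
      exact Or.inl ⟨hu, rfl⟩
    · rintro (⟨h, e⟩ | ⟨h, e⟩) <;> simp_all [projV]
  · constructor
    · intro h
      obtain rfl : u = w := by simpa [projV] using h
      exact Or.inr ⟨hu, rfl⟩
    · rintro (⟨h, e⟩ | ⟨h, e⟩) <;> simp_all [projV]
  · simp [projV]

theorem projV_inj {x y : SplitV A} {w : V} (hx : projV x = some w) (hy : projV y = some w) :
    x = y := by
  rcases projV_eq_some_iff.1 hx with ⟨h, rfl⟩ | ⟨h, rfl⟩ <;>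
    rcases projV_eq_some_iff.1 hy with ⟨h', rfl⟩ | ⟨h', rfl⟩
  · rfl
  · exact absurd h' h
  · exact absurd h h'
  · rfl

theorem exists_walk_support_eq_filterMap_projV (v : ↥(Aᶜ)) (t : List (SplitV A))
    (hL : (Sum.inl (v, true) :: t).IsChain (SplitArc G A))
    (hlast : (Sum.inl (v, true) :: t).getLast? = some (Sum.inr (Sum.inr ()))) :
    ∃ (a : ↥A) (p : G.Walk v a), p.support = (Sum.inl (v, true) :: t).filterMap projV := by
  match t with
  | [] => simp at hlast
  | [y] =>
    obtain rfl : y = Sum.inr (Sum.inr ()) := by simpa using hlast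
    rw [List.isChain_cons_cons] at hL
    nomatch hL.1
  | y :: z :: t =>
    rw [List.isChain_cons_cons, List.isChain_cons_cons] at hL
    obtain ⟨hy, hz, ht⟩ := hL
    rw [List.getLast?_cons_cons, List.getLast?_cons_cons] at hlast
    cases hy with
    | out_in _ w h =>
      cases hz
      obtain ⟨a, p, hp⟩ := exists_walk_support_eq_filterMap_projV w t ht hlast
      exact ⟨a, .cons h p, by simp [hp, projV]⟩
    | out_anchor _ a h =>
      cases hz
      cases t with
      | nil => exact ⟨a, .cons h .nil, by simp [projV]⟩
      | cons b t =>
        rw [List.isChain_cons_cons] at ht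
        nomatch ht.1

theorem IsDipath.exists_path {v : ↥(Aᶜ)} {L : List (SplitV A)}
    (hL : IsDipath (SplitArc G A) (Sum.inl (v, true)) (Sum.inr (Sum.inr ())) L) :
    ∃ (a : ↥A) (p : G.Walk v a), p.IsPath ∧ p.support = L.filterMap projV := by
  obtain ⟨hchain, hnodup, hhead, hlast⟩ := hL
  obtain ⟨t, rfl⟩ := List.head?_eq_some_iff.1 hhead
  obtain ⟨a, p, hp⟩ := exists_walk_support_eq_filterMap_projV v t hchain hlast
  refine ⟨a, p, ?_, hp⟩
  rw [SimpleGraph.Walk.isPath_def, hp]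
  exact hnodup.filterMap fun x y w hx hy => projV_inj hx hy

theorem IsDipath.anchor_arc_mem {x : SplitV A} {a : ↥A} {L : List (SplitV A)}
    (hL : IsDipath (SplitArc G A) x (Sum.inr (Sum.inr ())) L)
    (ha : (a : V) ∈ L.filterMap projV) :
    (Sum.inr (Sum.inl a), Sum.inr (Sum.inr ())) ∈ L.zip L.tail := by
  obtain ⟨z, hz, hza⟩ := List.mem_filterMap.1 ha
  obtain rfl : z = Sum.inr (Sum.inl a) := projV_inj hza rfl
  obtain ⟨y, hy, hR⟩ := List.IsChain.exists_mem_zip_tail_right hL.1 hz (by simp [hL.2.2.2])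
  cases hR
  exact hy

theorem IsDipath.agent_arc_mem {v w : ↥(Aᶜ)} {y : SplitV A} {L : List (SplitV A)}
    (hL : IsDipath (SplitArc G A) (Sum.inl (v, true)) y L)
    (hw : (w : V) ∈ L.filterMap projV) (hne : w ≠ v) :
    (Sum.inl (w, false), Sum.inl (w, true)) ∈ L.zip L.tail := by
  obtain ⟨z, hz, hzw⟩ := List.mem_filterMap.1 hw
  obtain rfl : z = Sum.inl (w, true) := projV_inj hzw rfl
  obtain ⟨u, hu, hR⟩ := List.IsChain.exists_mem_zip_tail_left hL.1 hz
    (by simpa [hL.2.2.1] using hne.symm)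
  cases hR
  exact hu

end SplitDigraph

theorem arc_disjoint_dipaths_to_disjoint_paths {V : Type*} [Fintype V]
    (G : SimpleGraph V) (A : Set V) (hA : A.Nonempty)
    (v : V) (hv : v ∈ Aᶜ)
    (L₁ L₂ : List (SplitV A))
    (hL₁ : IsDipath (SplitArc G A) (Sum.inl (⟨v, hv⟩, true)) (Sum.inr (Sum.inr ())) L₁)
    (hL₂ : IsDipath (SplitArc G A) (Sum.inl (⟨v, hv⟩, true)) (Sum.inr (Sum.inr ())) L₂)
    (harc : ∀ e ∈ L₁.zip L₁.tail, e ∉ L₂.zip L₂.tail) :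
    ∃ (a₁ a₂ : ↥A) (p₁ : G.Walk v ↑a₁) (p₂ : G.Walk v ↑a₂),
      p₁.IsPath ∧ p₂.IsPath ∧
      p₁.support = L₁.filterMap projV ∧
      p₂.support = L₂.filterMap projV ∧
      a₁ ≠ a₂ ∧
      (∀ w, w ∈ p₁.support → w ∈ p₂.support → w = v) := by
  obtain ⟨a₁, p₁, hp₁, hs₁⟩ := hL₁.exists_path
  obtain ⟨a₂, p₂, hp₂, hs₂⟩ := hL₂.exists_path
  refine ⟨a₁, a₂, p₁, p₂, hp₁, hp₂, hs₁, hs₂, ?_, ?_⟩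
  · rintro rfl
    exact harc _ (hL₁.anchor_arc_mem (hs₁ ▸ p₁.end_mem_support))
      (hL₂.anchor_arc_mem (hs₂ ▸ p₂.end_mem_support))
  · intro w h₁ h₂
    rw [hs₁] at h₁
    rw [hs₂] at h₂
    by_contra hne
    by_cases hw : w ∈ A
    · exact harc _ (hL₁.anchor_arc_mem (a := ⟨w, hw⟩) h₁) (hL₂.anchor_arc_mem h₂)
    · have hne' : (⟨w, hw⟩ : ↥(Aᶜ)) ≠ ⟨v, hv⟩ := fun h => hne (congrArg Subtype.val h)
      exact harc _ (hL₁.agent_arc_mem h₁ hne') (hL₂.agent_arc_mem h₂ hne')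
end

section
/- Let G be a finite simple graph whose vertex set V is partitioned into a set A of anchors and a set S = V \ A of agents, and let G' be the associated split digraph. For every agent v ∈ S and every natural number k, the following are equivalent: (i) there exist k paths in G from v to k pairwise distinct anchors, each with all internal vertices agents, that pairwise share no vertex other than v; (ii) there exist k directed paths in G' from (v, out) to Ω that pairwise share no arc. -/
/-- A path in `G` from an agent to an anchor, all of whose other vertices are agents, lifts to a
dipath in the split digraph ending at the sink. -/
theorem exists_isDipath_of_isPath {V : Type*} {G : SimpleGraph V} {A : Set V} {a : ↥A} {u : V}
    (p : G.Walk u ↑a) (hu : u ∈ Aᶜ) (hp : p.IsPath) (hA : ∀ w ∈ p.support, w ∈ A → w = ↑a) :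
    ∃ L : List (SplitV A),
      IsDipath (SplitArc G A) (Sum.inl (⟨u, hu⟩, true)) (Sum.inr (Sum.inr ())) L ∧
      (∀ w : ↥(Aᶜ), (Sum.inl (w, false) : SplitV A) ∈ L → ↑w ∈ p.support ∧ ↑w ≠ u) ∧
      (∀ w : ↥(Aᶜ), (Sum.inl (w, true) : SplitV A) ∈ L → ↑w ∈ p.support) ∧
      (∀ b : ↥A, (Sum.inr (Sum.inl b) : SplitV A) ∈ L → ↑b ∈ p.support) := by
  obtain ⟨a, ha⟩ := a
  dsimp only at p hA
  induction p with
  | nil => exact absurd ha hu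
  | @cons u b c h p ih =>
    rw [SimpleGraph.Walk.cons_isPath_iff] at hp
    by_cases hb : b ∈ A
    · refine ⟨[Sum.inl (⟨u, hu⟩, true), Sum.inr (Sum.inl ⟨b, hb⟩), Sum.inr (Sum.inr ())],
        ⟨?_, by simp, rfl, rfl⟩, by simp, by simp, by simp⟩
      exact .cons_cons (.out_anchor _ _ h) (.cons_cons (.anchor_sink _) (.singleton _))
    · obtain ⟨L, ⟨hc, hn, hh, hl⟩, hin, hout, hanc⟩ :=
        ih hb ha hp.1 (fun w hw => hA w (List.mem_cons_of_mem _ hw))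
      obtain ⟨T, rfl⟩ : ∃ T, L = Sum.inl (⟨b, hb⟩, true) :: T := by
        cases L with
        | nil => simp at hh
        | cons x T => exact ⟨T, by simpa using hh⟩
      refine ⟨Sum.inl (⟨u, hu⟩, true) :: Sum.inl (⟨b, hb⟩, false) ::
        Sum.inl (⟨b, hb⟩, true) :: T, ⟨?_, ?_, rfl, ?_⟩, ?_, ?_, ?_⟩
      · exact .cons_cons (.out_in _ _ h) (.cons_cons (.in_out _) hc)
      · refine List.nodup_cons.2 ⟨?_, List.nodup_cons.2 ⟨fun hm => (hin _ hm).2 rfl, hn⟩⟩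
        intro hm
        rcases List.mem_cons.1 hm with hm | hm
        · simp at hm
        · exact hp.2 (hout _ hm)
      · simpa using hl
      · intro w hw
        have hw' : ↑w ∈ p.support := by
          rcases List.mem_cons.1 hw with hw | hw
          · simp at hw
          rcases List.mem_cons.1 hw with hw | hw
          · obtain rfl : w = ⟨b, hb⟩ := by simpa using hw
            exact p.start_mem_support
          · exact (hin w hw).1
        refine ⟨List.mem_cons_of_mem _ hw', ?_⟩
        intro hwu
        exact hp.2 (hwu ▸ hw')
      · intro w hw
        rcases List.mem_cons.1 hw with hw | hw
        · obtain rfl : w = ⟨u, hu⟩ := by simpa using hw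
          simp
        rcases List.mem_cons.1 hw with hw | hw
        · simp at hw
        · exact List.mem_cons_of_mem _ (hout w hw)
      · intro x hx
        rcases List.mem_cons.1 hx with hx | hx
        · simp at hx
        rcases List.mem_cons.1 hx with hx | hx
        · simp at hx
        · exact List.mem_cons_of_mem _ (hanc x hx)

/-- A dipath in the split digraph from the out-copy of an agent to the sink projects to a path in
`G` ending at an anchor, whose vertices are recorded by the arcs of the dipath. -/
theorem exists_isPath_of_isDipath {V : Type*} {G : SimpleGraph V} {A : Set V}
    (L : List (SplitV A)) {u : V} (hu : u ∈ Aᶜ)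
    (hL : IsDipath (SplitArc G A) (Sum.inl (⟨u, hu⟩, true)) (Sum.inr (Sum.inr ())) L) :
    ∃ (a : ↥A) (p : G.Walk u ↑a), p.IsPath ∧
      (∀ w ∈ p.support, w ∈ A → w = ↑a) ∧
      ((Sum.inr (Sum.inl a), Sum.inr (Sum.inr ())) : SplitV A × SplitV A) ∈ L.zip L.tail ∧
      (∀ w ∈ p.support, ∀ h : w ∈ Aᶜ, (Sum.inl (⟨w, h⟩, true) : SplitV A) ∈ L) ∧
      (∀ w ∈ p.support, ∀ h : w ∈ Aᶜ, w ≠ u →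
        ((Sum.inl (⟨w, h⟩, false), Sum.inl (⟨w, h⟩, true)) : SplitV A × SplitV A) ∈
          L.zip L.tail) := by
  obtain ⟨hc, hn, hh, hl⟩ := hL
  match hLe : L with
  | [] => simp at hh
  | [x] =>
    simp only [List.head?_cons, List.getLast?_singleton] at hh hl
    exact absurd (hh.symm.trans hl) (by simp)
  | x :: y :: T =>
    obtain rfl : x = Sum.inl (⟨u, hu⟩, true) := by simpa using hh
    obtain ⟨hxy, hc⟩ := List.isChain_cons_cons.1 hc
    cases hxy with
    | out_anchor _ a h =>
      cases T with
      | nil => simp at hl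
      | cons z T =>
        obtain ⟨hyz, -⟩ := List.isChain_cons_cons.1 hc
        cases hyz
        have hua : u ≠ ↑a := fun e => hu (e ▸ a.2)
        refine ⟨a, .cons h .nil, by simpa using hua, ?_, by simp, ?_, ?_⟩
        · rintro w hw hwA
          rcases List.mem_cons.1 hw with rfl | hw
          · exact absurd hwA hu
          · simpa using hw
        · intro w hw hwA
          rcases List.mem_cons.1 hw with rfl | hw
          · simp
          · obtain rfl : w = ↑a := by simpa using hw
            exact absurd a.2 hwA
        · intro w hw hwA hwu
          rcases List.mem_cons.1 hw with rfl | hw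
          · exact absurd rfl hwu
          · obtain rfl : w = ↑a := by simpa using hw
            exact absurd a.2 hwA
    | out_in _ b h =>
      cases T with
      | nil => simp at hl
      | cons z T =>
        obtain ⟨hyz, hc⟩ := List.isChain_cons_cons.1 hc
        cases hyz
        obtain ⟨hn₁, hn⟩ := List.nodup_cons.1 hn
        obtain ⟨a, p, hp, hA, ha, hmem, harc⟩ := exists_isPath_of_isDipath
          (Sum.inl (b, true) :: T) b.2
          ⟨hc, (List.nodup_cons.1 hn).2, rfl, by simpa using hl⟩
        refine ⟨a, .cons h p, ?_, ?_, ?_, ?_, ?_⟩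
        · rw [SimpleGraph.Walk.cons_isPath_iff]
          exact ⟨hp, fun hup => hn₁ (List.mem_cons_of_mem _ (hmem u hup hu))⟩
        · intro w hw hwA
          rcases List.mem_cons.1 hw with rfl | hw
          · exact absurd hwA hu
          · exact hA w hw hwA
        · exact List.mem_cons_of_mem _ (List.mem_cons_of_mem _ ha)
        · intro w hw hwA
          rcases List.mem_cons.1 hw with rfl | hw
          · exact List.mem_cons_self
          · exact List.mem_cons_of_mem _ (List.mem_cons_of_mem _ (hmem w hw hwA))
        · intro w hw hwA hwu
          rcases List.mem_cons.1 hw with rfl | hw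
          · exact absurd rfl hwu
          · by_cases hwb : w = ↑b
            · subst hwb
              exact List.mem_cons_of_mem _ List.mem_cons_self
            · exact List.mem_cons_of_mem _ (List.mem_cons_of_mem _ (harc w hw hwA hwb))
termination_by L.length
decreasing_by
  rw [hLe]
  simp only [List.length_cons]
  lia

/-- Consecutive elements of a chain are related. -/
theorem List.IsChain.rel_of_mem_zip_tail {α : Type*} {R : α → α → Prop} {L : List α}
    (hL : L.IsChain R) {e : α × α} (he : e ∈ L.zip L.tail) : R e.1 e.2 := by
  induction L with
  | nil => simp at he
  | cons x L ih =>
    cases L with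
    | nil => simp at he
    | cons y L =>
      obtain ⟨hxy, hL⟩ := List.isChain_cons_cons.1 hL
      rcases List.mem_cons.1 he with rfl | he
      · exact hxy
      · exact ih hL he

theorem disjoint_paths_iff_arc_disjoint_dipaths {V : Type*} [Fintype V]
    (G : SimpleGraph V) (A : Set V) (hA : A.Nonempty)
    (v : V) (hv : v ∈ Aᶜ) (k : ℕ) :
    (∃ (a : Fin k → ↥A) (p : (i : Fin k) → G.Walk v ↑(a i)),
      Function.Injective a ∧
      (∀ i, (p i).IsPath) ∧
      (∀ i, ∀ w ∈ (p i).support, w ∈ A → w = ↑(a i)) ∧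
      (∀ i j, i ≠ j → ∀ w, w ∈ (p i).support → w ∈ (p j).support → w = v)) ↔
    (∃ L : Fin k → List (SplitV A),
      (∀ i, IsDipath (SplitArc G A) (Sum.inl (⟨v, hv⟩, true)) (Sum.inr (Sum.inr ())) (L i)) ∧
      (∀ i j, i ≠ j → ∀ e ∈ (L i).zip (L i).tail, e ∉ (L j).zip (L j).tail)) := by
  constructor
  · rintro ⟨a, p, -, hp, hA, hdisj⟩
    choose L hL hin _ hanc using fun i => exists_isDipath_of_isPath (p i) hv (hp i) (hA i)
    refine ⟨L, hL, ?_⟩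
    rintro i j hij ⟨x, y⟩ hei hej
    have hi := List.of_mem_zip hei
    have hj := List.of_mem_zip hej
    have no_in : ∀ w : ↥(Aᶜ), (Sum.inl (w, false) : SplitV A) ∈ L i →
        (Sum.inl (w, false) : SplitV A) ∉ L j := fun w h₁ h₂ =>
      (hin i w h₁).2 (hdisj i j hij w (hin i w h₁).1 (hin j w h₂).1)
    have no_anchor : ∀ b : ↥A, (Sum.inr (Sum.inl b) : SplitV A) ∈ L i →
        (Sum.inr (Sum.inl b) : SplitV A) ∉ L j := fun b h₁ h₂ =>
      hv (hdisj i j hij b (hanc i b h₁) (hanc j b h₂) ▸ b.2)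
    have hxy : SplitArc G A x y := List.IsChain.rel_of_mem_zip_tail (hL i).1 hei
    cases hxy with
    | in_out w => exact no_in w hi.1 hj.1
    | out_in u w _ => exact no_in w (List.mem_of_mem_tail hi.2) (List.mem_of_mem_tail hj.2)
    | out_anchor u b _ =>
      exact no_anchor b (List.mem_of_mem_tail hi.2) (List.mem_of_mem_tail hj.2)
    | anchor_sink b => exact no_anchor b hi.1 hj.1
  · rintro ⟨L, hL, hdisj⟩
    choose a p hp hA ha _ harc using fun i => exists_isPath_of_isDipath (L i) hv (hL i)
    have hinj : Function.Injective a := by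
      intro i j hij
      by_contra hne
      exact hdisj i j hne _ (ha i) (hij ▸ ha j)
    refine ⟨a, p, hinj, hp, hA, ?_⟩
    intro i j hij w hi hj
    by_contra hwv
    by_cases hwA : w ∈ A
    · exact hij (hinj (Subtype.ext ((hA i w hi hwA).symm.trans (hA j w hj hwA))))
    · exact hdisj i j hij _ (harc i w hi hwA hwv) (harc j w hj hwA hwv)
end

section
/- Let G be a finite simple graph whose vertex set V is partitioned into a set A of anchors and a set S = V \ A of agents, and fix a threshold k ∈ ℕ. Call a subset T ⊆ S feasible if every v ∈ T has k paths to k pairwise distinct anchors in the induced subgraph G[T ∪ A] that pairwise share no vertex other than v. Then the union of any two feasible subsets is feasible; consequently, the union V* of all feasible subsets of S is itself feasible and is the unique maximum feasible subset. -/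
/-!
STATEMENT 7. `G` is a finite simple graph on `V`, `A ⊆ V` the nonempty anchor set and
`S = Aᶜ` the agent set; fix a threshold `k : ℕ` (`k = 3` for BLL localizability).
Call `T ⊆ S` feasible if every `v ∈ T` has `k` pairwise internally disjoint paths to
`k` distinct anchors in the induced subgraph `G[T ∪ A]`.  Then the union of two
feasible sets is feasible; the union `V* = ⋃₀ {T | Feasible T}` of all feasible sets
is itself feasible and contains every feasible set, and it is the unique maximum
feasible subset.
-/

/-- `HasDisjointPathsTo G A U v k` says: in the subgraph of `G` induced on the vertex
set `U`, the node `v` has `k` paths ending at `k` pairwise distinct anchors of `A`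
such that any two of the paths share no vertex other than `v` (a path in the induced
subgraph `G[U]` being exactly a path of `G` all of whose support lies in `U`). -/
def HasDisjointPathsTo {V : Type*} (G : SimpleGraph V) (A : Set V) (U : Set V)
    (v : V) (k : ℕ) : Prop :=
  ∃ (a : Fin k → V) (p : (i : Fin k) → G.Walk v (a i)),
    (∀ i, a i ∈ A) ∧ Function.Injective a ∧
    (∀ i, (p i).IsPath) ∧
    (∀ i, ∀ w ∈ (p i).support, w ∈ U) ∧
    (∀ i j, i ≠ j → ∀ w, w ∈ (p i).support → w ∈ (p j).support → w = v)

/-- Enlarging the ambient vertex set keeps a family of disjoint paths available. -/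
theorem HasDisjointPathsTo.mono {V : Type*} {G : SimpleGraph V} {A U U' : Set V} {v : V} {k : ℕ}
    (h : HasDisjointPathsTo G A U v k) (hU : U ⊆ U') : HasDisjointPathsTo G A U' v k := by
  obtain ⟨a, p, ha, hinj, hp, hsupp, hdisj⟩ := h
  exact ⟨a, p, ha, hinj, hp, fun i w hw => hU (hsupp i w hw), hdisj⟩

theorem union_feasible_and_max_feasible {V : Type*} [Fintype V]
    (G : SimpleGraph V) (A : Set V) (hA : A.Nonempty) (k : ℕ)
    (Feasible : Set V → Prop)
    (hFeas : ∀ T, Feasible T ↔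
      (T ⊆ Aᶜ ∧ ∀ v ∈ T, HasDisjointPathsTo G A (T ∪ A) v k)) :
    (∀ T₁ T₂, Feasible T₁ → Feasible T₂ → Feasible (T₁ ∪ T₂)) ∧
    Feasible (⋃₀ {T | Feasible T}) ∧
    (∀ T, Feasible T → T ⊆ ⋃₀ {T | Feasible T}) ∧
    (∀ M, Feasible M → (∀ T, Feasible T → T ⊆ M) → M = ⋃₀ {T | Feasible T}) := by
  have sUnion_feasible : ∀ F : Set (Set V), (∀ T ∈ F, Feasible T) → Feasible (⋃₀ F) := by
    intro F hF
    refine (hFeas _).2 ⟨Set.sUnion_subset fun T hT => ((hFeas T).1 (hF T hT)).1, ?_⟩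
    rintro v ⟨T, hT, hv⟩
    exact (((hFeas T).1 (hF T hT)).2 v hv).mono
      (Set.union_subset_union_left A (Set.subset_sUnion_of_mem hT))
  have max_feasible : Feasible (⋃₀ {T | Feasible T}) := sUnion_feasible _ fun _ hT => hT
  refine ⟨fun T₁ T₂ h₁ h₂ => ?_, max_feasible, fun T hT => Set.subset_sUnion_of_mem hT,
    fun M hM hmax => (Set.subset_sUnion_of_mem hM).antisymm (hmax _ max_feasible)⟩
  rw [← Set.sUnion_pair]
  exact sUnion_feasible _ (by rintro T (rfl | rfl) <;> assumption)
end
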